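/- arXiv:2404.17181 — 4 statements merged into one kernel-verified Lean document; each statement's English description precedes it below -/
import Mathlib

section
/- No asymptotic underfitting for penalized minimum-risk model selection over a nested continuum of compact parameter sets (first half of Theorem 1). Let a < b be reals and for each k ∈ [a, b] let T_k ⊆ ℝ^d be nonempty and compact with T_k ⊆ T_l whenever k ≤ l. Let r : ℝ^d → ℝ be continuous and set m(k) = min_{β ∈ T_k} r(β). Suppose there exists k* ∈ [a, b] such that m(k*) ≤ m(k) for all k ∈ [a, b] and k* ≤ k for every k ∈ [a, b] with m(k) = m(k*). On a probability space (Ω, 𝓕, ℙ), for each n let R_n : Ω × ℝ^d → ℝ be jointly measurable with β ↦ R_n(ω, β) continuous, and suppose sup_{β ∈ T_b} |R_n(·, β) − r(β)| → 0 in probability as n → ∞. Let P_{k,n} : Ω → ℝ be penalties with P_{k,n}(ω) > 0 for all k, n, ω, with k ↦ P_{k,n}(ω) nondecreasing on [a, b], and with P_{k*,n} → 0 in probability. Let K̂_n : Ω → [a, b] be any random variable such that min_{β ∈ T_{K̂_n}} R_n(·, β) + P_{K̂_n, n} ≤ min_{β ∈ T_k} R_n(·, β) + P_{k,n} for all k ∈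 [a, b]. Then for every σ > 0, ℙ(K̂_n ≤ k* − σ) → 0 as n → ∞. -/
open MeasureTheory Filter Set

/-- Over a compact subset `s` of a compact set `t`, the minima of two continuous functions differ
by at most their uniform distance on `t`. -/
theorem sInf_image_le_sInf_image_add_iSup_abs_sub {E : Type*} [TopologicalSpace E] {s t : Set E}
    (hs : IsCompact s) (hne : s.Nonempty) (ht : IsCompact t) (hst : s ⊆ t) {f g : E → ℝ}
    (hf : Continuous f) (hg : Continuous g) :
    sInf (f '' s) ≤ sInf (g '' s) + ⨆ x : t, |f x - g x| := by
  obtain ⟨x, hx, hgx⟩ := hs.exists_sInf_image_eq hne hg.continuousOn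
  have hbdd : BddAbove (range fun x : t => |f x - g x|) := by
    have h := ht.bddAbove_image (hf.sub hg).abs.continuousOn
    rwa [image_eq_range] at h
  have hsup := le_ciSup hbdd ⟨x, hst hx⟩
  have hle : sInf (f '' s) ≤ f x :=
    csInf_le (hs.bddBelow_image hf.continuousOn) (mem_image_of_mem f hx)
  have habs := le_abs_self (f x - g x)
  simp only at hsup
  linarith

/-- No asymptotic underfitting for penalized minimum-risk model selection over a
nested continuum of compact parameter sets (first half of Theorem 1). -/
theorem panic_no_underfitting
    {Ω : Type*} [MeasurableSpace Ω] (μ : Measure Ω) [IsProbabilityMeasure μ]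
    {d : ℕ}
    (a b : ℝ) (hab : a < b)
    -- nested nonempty compact parameter sets
    (T : ℝ → Set (EuclideanSpace ℝ (Fin d)))
    (hTne : ∀ k ∈ Icc a b, (T k).Nonempty)
    (hTcomp : ∀ k ∈ Icc a b, IsCompact (T k))
    (hTmono : ∀ k l : ℝ, a ≤ k → k ≤ l → l ≤ b → T k ⊆ T l)
    -- continuous expected risk, with minimal value m k over T k
    (r : EuclideanSpace ℝ (Fin d) → ℝ) (hrcont : Continuous r)
    (m : ℝ → ℝ) (hm : ∀ k, m k = sInf (r '' T k))
    -- k* is the smallest minimizer of m over [a, b]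
    (kstar : ℝ) (hkstar_mem : kstar ∈ Icc a b)
    (hkstar_min : ∀ k ∈ Icc a b, m kstar ≤ m k)
    (hkstar_small : ∀ k ∈ Icc a b, m k = m kstar → kstar ≤ k)
    -- empirical risks, jointly measurable and continuous in β
    (R : ℕ → Ω → EuclideanSpace ℝ (Fin d) → ℝ)
    (hRmeas : ∀ n, Measurable (Function.uncurry (R n)))
    (hRcont : ∀ n ω, Continuous (R n ω))
    -- uniform convergence in probability of R n to r over T b
    (hunif : ∀ ε > (0 : ℝ),
      Tendsto (fun n => μ {ω | ε ≤ ⨆ β : T b, |R n ω β - r β|}) atTop (nhds 0))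
    -- penalties: positive, nondecreasing in k, with P (k*) → 0 in probability
    (Pen : ℝ → ℕ → Ω → ℝ)
    (hPpos : ∀ k ∈ Icc a b, ∀ n ω, 0 < Pen k n ω)
    (hPmono : ∀ n ω, MonotoneOn (fun k => Pen k n ω) (Icc a b))
    (hPstar : ∀ ε > (0 : ℝ),
      Tendsto (fun n => μ {ω | ε ≤ Pen kstar n ω}) atTop (nhds 0))
    -- K̂ n is any minimizer of the penalized minimal empirical risk over [a, b]
    (Khat : ℕ → Ω → ℝ) (hKhat_mem : ∀ n ω, Khat n ω ∈ Icc a b)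
    (hKhat_min : ∀ n ω, ∀ k ∈ Icc a b,
      sInf ((R n ω) '' T (Khat n ω)) + Pen (Khat n ω) n ω
        ≤ sInf ((R n ω) '' T k) + Pen k n ω) :
    ∀ σ > (0 : ℝ),
      Tendsto (fun n => μ {ω | Khat n ω ≤ kstar - σ}) atTop (nhds 0) := by
  intro σ hσ
  by_cases hlow : kstar - σ < a
  · have hempty : ∀ n, {ω | Khat n ω ≤ kstar - σ} = ∅ := fun n =>
      eq_empty_of_forall_notMem fun ω (hω : Khat n ω ≤ kstar - σ) =>
        absurd (hKhat_mem n ω).1 (by linarith)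
    simp [hempty]
  push Not at hlow
  have hk0 : kstar - σ ∈ Icc a b := ⟨hlow, by linarith [hkstar_mem.2]⟩
  have hgap : m kstar < m (kstar - σ) :=
    lt_of_le_of_ne (hkstar_min _ hk0) fun h => by linarith [hkstar_small _ hk0 h.symm]
  have hb : b ∈ Icc a b := right_mem_Icc.2 hab.le
  set δ := m (kstar - σ) - m kstar with hδ
  have hδpos : 0 < δ / 4 := by linarith
  have hlim := (hunif (δ / 4) hδpos).add (hPstar (δ / 4) hδpos)
  rw [add_zero] at hlim
  refine tendsto_of_tendsto_of_tendsto_of_le_of_le tendsto_const_nhds hlim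
    (fun _ => zero_le) fun n => (measure_mono ?_).trans (measure_union_le _ _)
  intro ω (hω : Khat n ω ≤ kstar - σ)
  by_contra hnot
  simp only [mem_union, mem_ofPred_eq, not_or, not_le] at hnot
  obtain ⟨hD, hP⟩ := hnot
  have hK := hKhat_mem n ω
  have hmK : m (kstar - σ) ≤ m (Khat n ω) := by
    rw [hm, hm]
    exact csInf_le_csInf ((hTcomp _ hk0).bddBelow_image hrcont.continuousOn)
      ((hTne _ hK).image r) (image_mono (hTmono _ _ hK.1 hω hk0.2))
  have hlower := sInf_image_le_sInf_image_add_iSup_abs_sub (hTcomp _ hK) (hTne _ hK)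
    (hTcomp b hb) (hTmono _ _ hK.1 hK.2 le_rfl) hrcont (hRcont n ω)
  have hupper := sInf_image_le_sInf_image_add_iSup_abs_sub (hTcomp _ hkstar_mem)
    (hTne _ hkstar_mem) (hTcomp b hb) (hTmono _ _ hkstar_mem.1 hkstar_mem.2 le_rfl)
    (hRcont n ω) hrcont
  simp only [abs_sub_comm (r _)] at hlower
  rw [← hm] at hlower hupper
  linarith [hKhat_min n ω kstar hkstar_mem, hPpos _ hK n ω]
end

section
/- No asymptotic overfitting for penalized minimum-risk model selection over a nested continuum of compact parameter sets (second half of Theorem 1). Let a < b be reals and for each k ∈ [a, b] let T_k ⊆ ℝ^d be nonempty and compact with T_k ⊆ T_l whenever k ≤ l. Let r : ℝ^d → ℝ be continuous and set m(k) = min_{β ∈ T_k} r(β). Suppose there exists k* ∈ [a, b] such that m(k*) ≤ m(k) for all k ∈ [a, b] and k* ≤ k for every k ∈ [a, b] with m(k) = m(k*). On a probability space (Ω, 𝓕, ℙ), for each n let R_n : Ω × ℝ^d → ℝ be jointly measurable with β ↦ R_n(ω, β) continuous. Assume the tightness condition: the sequence √n·(min_{β ∈ T_{k*}} R_n(·,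 β) − min_{β ∈ T_b} R_n(·, β)) is bounded in probability, i.e., for every δ > 0 there exist M > 0 and N such that ℙ(√n·(min_{T_{k*}} R_n − min_{T_b} R_n) > M) ≤ δ for all n ≥ N. Let P_{k,n} : Ω → ℝ be penalties with k ↦ P_{k,n}(ω) nondecreasing on [a, b] for every n and ω, and such that for every σ > 0 with k* + σ ≤ b, √n·(P_{k*+σ, n} − P_{k*, n}) → ∞ in probability. Let K̂_n : Ω → [a, b] be any random variable such that min_{β ∈ T_{K̂_n}} R_n(·, β) + P_{K̂_n, n} ≤ min_{β ∈ T_k} R_n(·, β) + P_{k,n} for all k ∈ [a, b]. Then for every σ > 0, ℙ(K̂_n ≥ k* + σ) → 0 as n → ∞. -/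
open MeasureTheory Filter Set

/-- No asymptotic overfitting for penalized minimum-risk model selection over a
nested continuum of compact parameter sets (second half of Theorem 1). -/
theorem panic_no_overfitting
    {Ω : Type*} [MeasurableSpace Ω] (μ : Measure Ω) [IsProbabilityMeasure μ]
    {d : ℕ}
    (a b : ℝ) (hab : a < b)
    -- nested nonempty compact parameter sets
    (T : ℝ → Set (EuclideanSpace ℝ (Fin d)))
    (hTne : ∀ k ∈ Icc a b, (T k).Nonempty)
    (hTcomp : ∀ k ∈ Icc a b, IsCompact (T k))
    (hTmono : ∀ k l : ℝ, a ≤ k → k ≤ l → l ≤ b → T k ⊆ T l)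
    -- continuous expected risk, with minimal value m k over T k
    (r : EuclideanSpace ℝ (Fin d) → ℝ) (hrcont : Continuous r)
    (m : ℝ → ℝ) (hm : ∀ k, m k = sInf (r '' T k))
    -- k* is the smallest minimizer of m over [a, b]
    (kstar : ℝ) (hkstar_mem : kstar ∈ Icc a b)
    (hkstar_min : ∀ k ∈ Icc a b, m kstar ≤ m k)
    (hkstar_small : ∀ k ∈ Icc a b, m k = m kstar → kstar ≤ k)
    -- empirical risks, jointly measurable and continuous in β
    (R : ℕ → Ω → EuclideanSpace ℝ (Fin d) → ℝ)
    (hRmeas : ∀ n, Measurable (Function.uncurry (R n)))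
    (hRcont : ∀ n ω, Continuous (R n ω))
    -- tightness: √n (min_{T k*} R n - min_{T b} R n) is bounded in probability
    (htight : ∀ δ : ENNReal, 0 < δ → ∃ M > (0 : ℝ), ∃ N : ℕ, ∀ n ≥ N,
      μ {ω | M < Real.sqrt n * (sInf ((R n ω) '' T kstar) - sInf ((R n ω) '' T b))} ≤ δ)
    -- penalties: nondecreasing in k, with √n (P (k*+σ) - P k*) → ∞ in probability
    (Pen : ℝ → ℕ → Ω → ℝ)
    (hPmono : ∀ n ω, MonotoneOn (fun k => Pen k n ω) (Icc a b))
    (hPdiv : ∀ σ > (0 : ℝ), kstar + σ ≤ b → ∀ M > (0 : ℝ),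
      Tendsto (fun n : ℕ => μ {ω | Real.sqrt n * (Pen (kstar + σ) n ω - Pen kstar n ω) ≤ M})
        atTop (nhds 0))
    -- K̂ n is any minimizer of the penalized minimal empirical risk over [a, b]
    (Khat : ℕ → Ω → ℝ) (hKhat_mem : ∀ n ω, Khat n ω ∈ Icc a b)
    (hKhat_min : ∀ n ω, ∀ k ∈ Icc a b,
      sInf ((R n ω) '' T (Khat n ω)) + Pen (Khat n ω) n ω
        ≤ sInf ((R n ω) '' T k) + Pen k n ω) :
    ∀ σ > (0 : ℝ),
      Tendsto (fun n => μ {ω | kstar + σ ≤ Khat n ω}) atTop (nhds 0) := by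
  intro σ hσ
  by_cases hb : kstar + σ ≤ b
  swap
  · have hempty : ∀ n, {ω | kstar + σ ≤ Khat n ω} = ∅ := fun n =>
      eq_empty_of_forall_notMem fun ω hω => hb (le_trans hω (hKhat_mem n ω).2)
    simp [hempty]
  rw [ENNReal.tendsto_nhds_zero]
  intro ε hε
  obtain ⟨M, hM, N, hN⟩ := htight (ε / 2) (ENNReal.half_pos hε.ne')
  have hdiv := ENNReal.tendsto_nhds_zero.1 (hPdiv σ hσ hb M hM) (ε / 2) (ENNReal.half_pos hε.ne')
  filter_upwards [hdiv, eventually_ge_atTop N] with n hn hnN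
  calc μ {ω | kstar + σ ≤ Khat n ω}
      ≤ μ ({ω | √n * (Pen (kstar + σ) n ω - Pen kstar n ω) ≤ M} ∪
          {ω | M < √n * (sInf (R n ω '' T kstar) - sInf (R n ω '' T b))}) := by
        refine measure_mono fun ω hω => ?_
        have hω : kstar + σ ≤ Khat n ω := hω
        have hK := hKhat_mem n ω
        have hbmem : b ∈ Icc a b := right_mem_Icc.2 hab.le
        have hrisk : sInf (R n ω '' T b) ≤ sInf (R n ω '' T (Khat n ω)) :=
          csInf_le_csInf ((hTcomp b hbmem).image (hRcont n ω)).bddBelow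
            ((hTne _ hK).image _) (image_mono (hTmono _ _ hK.1 hK.2 le_rfl))
        have hpen : Pen (kstar + σ) n ω ≤ Pen (Khat n ω) n ω :=
          hPmono n ω ⟨by linarith [hkstar_mem.1], hb⟩ hK hω
        have hmin := hKhat_min n ω kstar hkstar_mem
        have hle : √n * (Pen (kstar + σ) n ω - Pen kstar n ω) ≤
            √n * (sInf (R n ω '' T kstar) - sInf (R n ω '' T b)) :=
          mul_le_mul_of_nonneg_left (by linarith) (Real.sqrt_nonneg _)
        exact (le_or_gt _ M).imp id fun h => h.trans_le hle
    _ ≤ ε / 2 + ε / 2 := (measure_union_le _ _).trans (add_le_add hn (hN n hnN))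
    _ = ε := ENNReal.add_halves ε
end

section
/- Continuity of the regularization path of the constraint value (Lemma 1). Let f : ℝ^d → ℝ be continuous, strictly convex, and nonnegative, and let g : ℝ^d → ℝ be continuous, convex, and nonnegative such that for some c ≥ 0 the sublevel set L_c = {β ∈ ℝ^d : g(β) ≤ c} is nonempty and bounded. For each λ > 0, let β_λ ∈ ℝ^d be the unique global minimizer of β ↦ f(β) + λ·g(β) over ℝ^d (such a unique minimizer exists). Then the map 𝓛 : (0, ∞) → ℝ defined by 𝓛(λ) = g(β_λ) is continuous on (0, ∞). -/
open Set

/-- If one nonempty sublevel set of a continuous convex function on a finite-dimensional space is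
bounded, then all of its sublevel sets are bounded. -/
theorem ConvexOn.isBounded_sublevel_of_isBounded_sublevel
    {E : Type*} [NormedAddCommGroup E] [NormedSpace ℝ E] [ProperSpace E]
    {g : E → ℝ} (hconv : ConvexOn ℝ univ g) (hcont : Continuous g) {c : ℝ}
    (hne : {x | g x ≤ c}.Nonempty) (hbdd : Bornology.IsBounded {x | g x ≤ c}) (M : ℝ) :
    Bornology.IsBounded {x | g x ≤ M} := by
  obtain ⟨x₀, hx₀⟩ := hne
  obtain ⟨R, hR0, hR⟩ := hbdd.subset_ball_lt 0 x₀
  by_cases hS : (Metric.sphere x₀ R).Nonempty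
  · obtain ⟨z, hz, hzmin⟩ := (isCompact_sphere x₀ R).exists_isMinOn hS hcont.continuousOn
    have hcz : c < g z := by
      by_contra! h
      have : z ∈ Metric.ball x₀ R := hR h
      rw [Metric.mem_ball] at this
      rw [Metric.mem_sphere] at hz
      linarith
    refine (Metric.isBounded_closedBall (x := x₀)
      (r := max R (R * (M - c) / (g z - c)))).subset fun x hx => ?_
    rw [Metric.mem_closedBall, dist_eq_norm]
    rcases le_total ‖x - x₀‖ R with h | h
    · exact h.trans (le_max_left _ _)
    refine le_trans ?_ (le_max_right _ _)
    have hpos : 0 < ‖x - x₀‖ := hR0.trans_le h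
    set t := R / ‖x - x₀‖ with ht
    have ht0 : 0 ≤ t := by positivity
    have ht1 : t ≤ 1 := (div_le_one hpos).2 h
    have hmem : (1 - t) • x₀ + t • x ∈ Metric.sphere x₀ R := by
      have e : (1 - t) • x₀ + t • x - x₀ = t • (x - x₀) := by module
      rw [Metric.mem_sphere, dist_eq_norm, e, norm_smul, Real.norm_of_nonneg ht0, ht,
        div_mul_cancel₀ _ hpos.ne']
    have h1 : g z ≤ g ((1 - t) • x₀ + t • x) := hzmin hmem
    have h2 := hconv.2 (mem_univ x₀) (mem_univ x) (sub_nonneg.2 ht1) ht0 (by ring)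
    simp only [smul_eq_mul] at h2
    have h3 : g z - c ≤ t * (M - c) := by
      have h4 : (1 - t) * g x₀ ≤ (1 - t) * c :=
        mul_le_mul_of_nonneg_left hx₀ (sub_nonneg.2 ht1)
      have h5 : t * g x ≤ t * M := mul_le_mul_of_nonneg_left hx ht0
      linarith
    rw [le_div_iff₀ (sub_pos.2 hcz)]
    calc ‖x - x₀‖ * (g z - c) ≤ ‖x - x₀‖ * (t * (M - c)) := by gcongr
      _ = R * (M - c) := by rw [ht]; field_simp
  · refine (Metric.isBounded_closedBall (x := x₀) (r := R)).subset fun x _ => ?_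
    rw [Metric.mem_closedBall, dist_eq_norm]
    by_contra! h
    have hpos : 0 < ‖x - x₀‖ := hR0.trans h
    refine hS ⟨x₀ + (R / ‖x - x₀‖) • (x - x₀), ?_⟩
    rw [Metric.mem_sphere, dist_eq_norm, add_sub_cancel_left, norm_smul,
      Real.norm_of_nonneg (by positivity), div_mul_cancel₀ _ hpos.ne']

open Filter Topology in
/-- Continuity of the regularization path of the constraint value (Lemma 1). -/
theorem regularization_path_continuous
    {d : ℕ}
    (f g : EuclideanSpace ℝ (Fin d) → ℝ)
    (hfcont : Continuous f) (hfconv : StrictConvexOn ℝ univ f) (hf0 : ∀ β, 0 ≤ f β)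
    (hgcont : Continuous g) (hgconv : ConvexOn ℝ univ g) (hg0 : ∀ β, 0 ≤ g β)
    (c : ℝ) (hc : 0 ≤ c)
    (hLne : {β : EuclideanSpace ℝ (Fin d) | g β ≤ c}.Nonempty)
    (hLbdd : Bornology.IsBounded {β : EuclideanSpace ℝ (Fin d) | g β ≤ c})
    -- B lam is the unique global minimizer of f + lam • g
    (B : ℝ → EuclideanSpace ℝ (Fin d))
    (hBmin : ∀ lam > (0 : ℝ), ∀ β, f (B lam) + lam * g (B lam) ≤ f β + lam * g β)
    (hBuniq : ∀ lam > (0 : ℝ), ∀ β',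
      (∀ β, f β' + lam * g β' ≤ f β + lam * g β) → β' = B lam) :
    ContinuousOn (fun lam => g (B lam)) (Ioi (0 : ℝ)) := by
  intro l hl
  have hl0 : 0 < l := hl
  suffices h : Tendsto B (𝓝 l) (𝓝 (B l)) from
    ((hgcont.tendsto _).comp h).mono_left nhdsWithin_le_nhds
  obtain ⟨M, hM⟩ : ∃ M, M = f 0 / (l / 2) + g 0 := ⟨_, rfl⟩
  have hK : IsCompact {β | g β ≤ M} := Metric.isCompact_of_isClosed_isBounded
    (isClosed_le hgcont continuous_const)
    (hgconv.isBounded_sublevel_of_isBounded_sublevel hgcont hLne hLbdd M)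
  have hmem : ∀ᶠ m in 𝓝 l, B m ∈ {β | g β ≤ M} := by
    filter_upwards [lt_mem_nhds (half_lt_self hl0)] with m hm
    have hm0 : 0 < m := (half_pos hl0).trans hm
    have h1 := hBmin m hm0 0
    have h2 : f 0 / m ≤ f 0 / (l / 2) := div_le_div_of_nonneg_left (hf0 0) (half_pos hl0) hm.le
    have h3 : g (B m) - g 0 ≤ f 0 / m := by
      rw [le_div_iff₀ hm0]
      linarith [hf0 (B m)]
    change g (B m) ≤ M
    linarith
  refine tendsto_iff_ultrafilter _ _ _ |>.2 fun u hu => ?_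
  obtain ⟨b, -, hb⟩ := hK.ultrafilter_le_nhds (u.map B) (le_principal_iff.2 (hu hmem))
  have hBb : Tendsto B u (𝓝 b) := hb
  have hid : Tendsto (fun m : ℝ => m) u (𝓝 l) := hu
  have hbl : b = B l := hBuniq l hl0 b fun β => by
    refine le_of_tendsto_of_tendsto
      (((hfcont.tendsto b).comp hBb).add (hid.mul ((hgcont.tendsto b).comp hBb)))
      ((tendsto_const_nhds (x := f β)).add (hid.mul (tendsto_const_nhds (x := g β)))) ?_
    filter_upwards [hu (lt_mem_nhds hl0)] with m hm using hBmin m hm β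
  exact hbl ▸ hBb
end

section
/- Lipschitz envelope for the Gamma negative log-likelihood loss on ℓ1 balls (condition A3 for Gamma regression, Proposition 1). Let ν > 0, C > 0, x ∈ ℝ^d, y > 0, and define ℓ(x, y; β) = ν·⟪β, x⟫ + ν·y·exp(−⟪β, x⟫). Then for all β, β' ∈ ℝ^d with ‖β‖₁ ≤ C and ‖β'‖₁ ≤ C, |ℓ(x, y; β) − ℓ(x, y; β')| ≤ ν·(1 + y·exp(2·C·‖x‖₁))·‖x‖₁·‖β − β'‖₂. -/
open scoped RealInnerProductSpace

/-- Hölder's inequality for the Euclidean inner product, with exponents `∞` and `1`. -/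
lemma abs_inner_le_mul_sum_abs {d : ℕ} {M : ℝ} (v x : EuclideanSpace ℝ (Fin d))
    (hv : ∀ j, |v j| ≤ M) : |⟪v, x⟫| ≤ M * ∑ j, |x j| := by
  rw [PiLp.inner_apply, Finset.mul_sum]
  refine (Finset.abs_sum_le_sum_abs _ _).trans (Finset.sum_le_sum fun j _ => ?_)
  rw [RCLike.inner_apply, conj_trivial, abs_mul, mul_comm]
  exact mul_le_mul_of_nonneg_right (hv j) (abs_nonneg _)

/-- The exponential function is `exp K`-Lipschitz on `(-∞, K]`. -/
lemma abs_exp_sub_exp_le {a b K : ℝ} (ha : a ≤ K) (hb : b ≤ K) :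
    |Real.exp a - Real.exp b| ≤ Real.exp K * |a - b| := by
  wlog h : b ≤ a generalizing a b
  · rw [abs_sub_comm, abs_sub_comm a]
    exact this hb ha (le_of_not_ge h)
  rw [abs_of_nonneg (sub_nonneg.2 (Real.exp_le_exp.2 h)), abs_of_nonneg (sub_nonneg.2 h)]
  calc Real.exp a - Real.exp b = Real.exp a * (1 - Real.exp (b - a)) := by
        rw [mul_sub, ← Real.exp_add]; ring_nf
    _ ≤ Real.exp a * (a - b) := by
        refine mul_le_mul_of_nonneg_left ?_ (Real.exp_nonneg a)
        linarith [Real.add_one_le_exp (b - a)]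
    _ ≤ Real.exp K * (a - b) :=
        mul_le_mul_of_nonneg_right (Real.exp_le_exp.2 ha) (sub_nonneg.2 h)

/-- Lipschitz envelope for the Gamma negative log-likelihood loss on ℓ1 balls
(condition A3 for Gamma regression, Proposition 1). -/
theorem gamma_loss_lipschitz_envelope
    {d : ℕ} (ν : ℝ) (hν : 0 < ν) (C : ℝ) (hC : 0 < C)
    (x : EuclideanSpace ℝ (Fin d)) (y : ℝ) (hy : 0 < y)
    (ℓ : EuclideanSpace ℝ (Fin d) → ℝ → EuclideanSpace ℝ (Fin d) → ℝ)
    (hℓ : ∀ x y β, ℓ x y β = ν * ⟪β, x⟫ + ν * y * Real.exp (-⟪β, x⟫))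
    (β β' : EuclideanSpace ℝ (Fin d))
    (hβ : ∑ j, |β j| ≤ C) (hβ' : ∑ j, |β' j| ≤ C) :
    |ℓ x y β - ℓ x y β'|
      ≤ ν * (1 + y * Real.exp (2 * C * ∑ j, |x j|)) * (∑ j, |x j|) * ‖β - β'‖ := by
  set S := ∑ j, |x j|
  have hS : 0 ≤ S := Finset.sum_nonneg fun j _ => abs_nonneg _
  have neg_inner_le {γ : EuclideanSpace ℝ (Fin d)} (hγ : ∑ j, |γ j| ≤ C) :
      -⟪γ, x⟫ ≤ 2 * C * S := by
    have h := abs_inner_le_mul_sum_abs γ x fun j =>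
      (Finset.single_le_sum (fun i _ => abs_nonneg (γ i)) (Finset.mem_univ j)).trans hγ
    linarith [neg_le_abs ⟪γ, x⟫, mul_nonneg hC.le hS]
  have hinner : |⟪β, x⟫ - ⟪β', x⟫| ≤ ‖β - β'‖ * S := by
    rw [← inner_sub_left]
    exact abs_inner_le_mul_sum_abs _ x fun j => PiLp.norm_apply_le (β - β') j
  have hexp := abs_exp_sub_exp_le (neg_inner_le hβ) (neg_inner_le hβ')
  rw [neg_sub_neg, abs_sub_comm ⟪β', x⟫] at hexp
  rw [hℓ, hℓ]
  calc _ = ν * |(⟪β, x⟫ - ⟪β', x⟫) + y * (Real.exp (-⟪β, x⟫) - Real.exp (-⟪β', x⟫))| := by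
        rw [← abs_of_pos hν, ← abs_mul, abs_of_pos hν]; ring_nf
    _ ≤ ν * (|⟪β, x⟫ - ⟪β', x⟫| + y * |Real.exp (-⟪β, x⟫) - Real.exp (-⟪β', x⟫)|) := by
        gcongr
        refine (abs_add_le _ _).trans_eq ?_
        rw [abs_mul, abs_of_pos hy]
    _ ≤ ν * (|⟪β, x⟫ - ⟪β', x⟫| + y * (Real.exp (2 * C * S) * |⟪β, x⟫ - ⟪β', x⟫|)) := by
        gcongr
    _ = ν * (1 + y * Real.exp (2 * C * S)) * |⟪β, x⟫ - ⟪β', x⟫| := by ring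
    _ ≤ ν * (1 + y * Real.exp (2 * C * S)) * (‖β - β'‖ * S) := by gcongr
    _ = _ := by ring
end
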